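/- arXiv:2503.09870 — 4 statements merged into one kernel-verified Lean document; each statement's English description precedes it below -/
import Mathlib

section
/- Fix coprime integers p, q ≥ 2 and integers a, b with a·p + b·q = 1. The group presented by ⟨u, v, h | u^p h^b, v^q h^a, uhu⁻¹h⁻¹, vhv⁻¹h⁻¹⟩ (i.e., with relations u^p = h^{−b}, v^q = h^{−a}, uh = hu, vh = hv) is isomorphic to the group presented by ⟨x, y | x^p y^{−q}⟩ (i.e., with relation x^p = y^q), via an isomorphism sending u ↦ x^{−b}, v ↦ y^{−a}, and h ↦ x^p. -/
/-- If `u` commutes with `h`, `u ^ p = h ^ (-b)` and `a * p + b * q = 1`, then `h ^ a * u ^ (-q)` is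
a `p`-th root of `h`. -/
theorem Commute.zpow_mul_zpow_neg_zpow_eq_right {G : Type*} [Group G] {u h : G} {p q a b : ℤ}
    (hab : a * p + b * q = 1) (hc : Commute u h) (hr : u ^ p * h ^ b = 1) :
    (h ^ a * u ^ (-q)) ^ p = h := by
  have hu : u ^ p = h ^ (-b) := by rw [zpow_neg]; exact eq_inv_of_mul_eq_one_left hr
  rw [(hc.symm.zpow_zpow a (-q)).mul_zpow, ← zpow_mul, ← zpow_mul, mul_comm (-q) p, zpow_mul u,
    hu, ← zpow_mul, ← zpow_add, neg_mul_neg, hab, zpow_one]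

/-- If `u` commutes with `h`, `u ^ p = h ^ (-b)` and `a * p + b * q = 1`, then `u` is the `(-b)`-th
power of `h ^ a * u ^ (-q)`. -/
theorem Commute.zpow_mul_zpow_neg_zpow_neg_eq_left {G : Type*} [Group G] {u h : G}
    {p q a b : ℤ} (hab : a * p + b * q = 1) (hc : Commute u h) (hr : u ^ p * h ^ b = 1) :
    (h ^ a * u ^ (-q)) ^ (-b) = u := by
  have hu : h ^ (-b) = u ^ p := by rw [zpow_neg]; exact (eq_inv_of_mul_eq_one_left hr).symm
  rw [(hc.symm.zpow_zpow a (-q)).mul_zpow, ← zpow_mul, ← zpow_mul, mul_comm a (-b), zpow_mul h,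
    hu, ← zpow_mul, ← zpow_add, show p * a + -q * -b = 1 by linarith, zpow_one]

theorem zpow_zpow_mul_zpow_neg_zpow_neg {G : Type*} [Group G] {p q a b : ℤ}
    (hab : a * p + b * q = 1) (x : G) : (x ^ p) ^ a * (x ^ (-b)) ^ (-q) = x := by
  rw [← zpow_mul, ← zpow_mul, ← zpow_add, show p * a + -b * -q = 1 by linarith, zpow_one]

/-- The Seifert-fibered presentation `⟨u, v, h | u^p = h^(-b), v^q = h^(-a), uh = hu, vh = hv⟩`
of the torus knot group is isomorphic to the standard presentation `⟨x, y | x^p = y^q⟩`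
via `u ↦ x^(-b)`, `v ↦ y^(-a)`, `h ↦ x^p`. -/
theorem stmt1 (p q a b : ℤ) (hp : 2 ≤ p) (hq : 2 ≤ q) (hpq : IsCoprime p q)
    (hab : a * p + b * q = 1) :
    -- generators of the first presentation: `0 ↦ u`, `1 ↦ v`, `2 ↦ h`
    -- generators of the second presentation: `0 ↦ x`, `1 ↦ y`
    ∃ e : PresentedGroup
        ({FreeGroup.of 0 ^ p * FreeGroup.of 2 ^ b,
          FreeGroup.of 1 ^ q * FreeGroup.of 2 ^ a,
          FreeGroup.of 0 * FreeGroup.of 2 * (FreeGroup.of 0)⁻¹ * (FreeGroup.of 2)⁻¹,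
          FreeGroup.of 1 * FreeGroup.of 2 * (FreeGroup.of 1)⁻¹ * (FreeGroup.of 2)⁻¹}
          : Set (FreeGroup (Fin 3)))
      ≃* PresentedGroup ({FreeGroup.of 0 ^ p * FreeGroup.of 1 ^ (-q)} : Set (FreeGroup (Fin 2))),
      e (PresentedGroup.of 0) = PresentedGroup.of 0 ^ (-b) ∧
      e (PresentedGroup.of 1) = PresentedGroup.of 1 ^ (-a) ∧
      e (PresentedGroup.of 2) = PresentedGroup.of 0 ^ p := by
  set R : Set (FreeGroup (Fin 3)) := {FreeGroup.of 0 ^ p * FreeGroup.of 2 ^ b,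
          FreeGroup.of 1 ^ q * FreeGroup.of 2 ^ a,
          FreeGroup.of 0 * FreeGroup.of 2 * (FreeGroup.of 0)⁻¹ * (FreeGroup.of 2)⁻¹,
          FreeGroup.of 1 * FreeGroup.of 2 * (FreeGroup.of 1)⁻¹ * (FreeGroup.of 2)⁻¹} with hR
  set S : Set (FreeGroup (Fin 2)) := {FreeGroup.of 0 ^ p * FreeGroup.of 1 ^ (-q)} with hS
  have hba : b * q + a * p = 1 := by linarith
  let u : PresentedGroup R := PresentedGroup.of 0
  let v : PresentedGroup R := PresentedGroup.of 1
  let h : PresentedGroup R := PresentedGroup.of 2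
  let x : PresentedGroup S := PresentedGroup.of 0
  let y : PresentedGroup S := PresentedGroup.of 1
  have hu : u ^ p * h ^ b = 1 :=
    PresentedGroup.one_of_mem (rels := R) (x := FreeGroup.of 0 ^ p * FreeGroup.of 2 ^ b)
      (by simp [hR])
  have hv : v ^ q * h ^ a = 1 :=
    PresentedGroup.one_of_mem (rels := R) (x := FreeGroup.of 1 ^ q * FreeGroup.of 2 ^ a)
      (by simp [hR])
  have huh : Commute u h := commutatorElement_eq_one_iff_commute.mp <|
    PresentedGroup.one_of_mem (rels := R)
      (x := FreeGroup.of 0 * FreeGroup.of 2 * (FreeGroup.of 0)⁻¹ * (FreeGroup.of 2)⁻¹)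
      (by simp [hR])
  have hvh : Commute v h := commutatorElement_eq_one_iff_commute.mp <|
    PresentedGroup.one_of_mem (rels := R)
      (x := FreeGroup.of 1 * FreeGroup.of 2 * (FreeGroup.of 1)⁻¹ * (FreeGroup.of 2)⁻¹)
      (by simp [hR])
  have hxy : x ^ p = y ^ q := by
    have hrel : x ^ p * y ^ (-q) = 1 :=
      PresentedGroup.one_of_mem (rels := S) (x := FreeGroup.of 0 ^ p * FreeGroup.of 1 ^ (-q))
        (by simp [hS])
    rwa [zpow_neg, mul_inv_eq_one] at hrel
  have hf : ∀ r ∈ R, FreeGroup.lift ![x ^ (-b), y ^ (-a), x ^ p] r = 1 := by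
    rintro r (rfl | rfl | rfl | rfl)
    · simp only [map_mul, map_zpow, FreeGroup.lift_apply_of, Matrix.cons_val]
      rw [← zpow_mul, ← zpow_mul, ← zpow_add, show -b * p + p * b = 0 by ring, zpow_zero]
    · simp only [map_mul, map_zpow, FreeGroup.lift_apply_of, Matrix.cons_val]
      rw [hxy, ← zpow_mul, ← zpow_mul, ← zpow_add, show -a * q + q * a = 0 by ring, zpow_zero]
    · simp only [map_mul, map_inv, FreeGroup.lift_apply_of, Matrix.cons_val]
      exact commutatorElement_eq_one_iff_commute.mpr ((Commute.refl x).zpow_zpow _ _)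
    · simp only [map_mul, map_inv, FreeGroup.lift_apply_of, Matrix.cons_val]
      rw [hxy]
      exact commutatorElement_eq_one_iff_commute.mpr ((Commute.refl y).zpow_zpow _ _)
  have hxp : (h ^ a * u ^ (-q)) ^ p = h := huh.zpow_mul_zpow_neg_zpow_eq_right hab hu
  have hyq : (h ^ b * v ^ (-p)) ^ q = h := hvh.zpow_mul_zpow_neg_zpow_eq_right hba hv
  have hg : ∀ r ∈ S, FreeGroup.lift ![h ^ a * u ^ (-q), h ^ b * v ^ (-p)] r = 1 := by
    rintro r rfl
    simp only [map_mul, map_zpow, FreeGroup.lift_apply_of, Matrix.cons_val]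
    rw [hxp, zpow_neg _ q, hyq, mul_inv_cancel]
  let f : PresentedGroup R →* PresentedGroup S := PresentedGroup.toGroup hf
  let g : PresentedGroup S →* PresentedGroup R := PresentedGroup.toGroup hg
  have fu : f u = x ^ (-b) := PresentedGroup.toGroup.of hf
  have fv : f v = y ^ (-a) := PresentedGroup.toGroup.of hf
  have fh : f h = x ^ p := PresentedGroup.toGroup.of hf
  have gx : g x = h ^ a * u ^ (-q) := PresentedGroup.toGroup.of hg
  have gy : g y = h ^ b * v ^ (-p) := PresentedGroup.toGroup.of hg
  have hgf : g.comp f = MonoidHom.id _ := by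
    ext i
    fin_cases i
    · change g (f u) = u
      rw [fu, map_zpow, gx, huh.zpow_mul_zpow_neg_zpow_neg_eq_left hab hu]
    · change g (f v) = v
      rw [fv, map_zpow, gy, hvh.zpow_mul_zpow_neg_zpow_neg_eq_left hba hv]
    · change g (f h) = h
      rw [fh, map_zpow, gx, hxp]
  have hfg : f.comp g = MonoidHom.id _ := by
    ext i
    fin_cases i
    · change f (g x) = x
      rw [gx, map_mul, map_zpow, map_zpow, fh, fu, zpow_zpow_mul_zpow_neg_zpow_neg hab]
    · change f (g y) = y
      rw [gy, map_mul, map_zpow, map_zpow, fh, fv, hxy, zpow_zpow_mul_zpow_neg_zpow_neg hba]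
  exact ⟨f.toMulEquiv g hgf hfg, fu, fv, fh⟩
end

section
/- Let p, q ≥ 2 be integers and let a, b be integers with a·p + b·q = 1 (so that b is invertible modulo p and a is invertible modulo q). Let G = (ℤ/p) ∗ (ℤ/q) be the free product of cyclic groups of orders p and q, with x̄ ∈ G the image of a fixed generator of ℤ/p and ȳ ∈ G the image of a fixed generator of ℤ/q. Let c ≥ 2 be an even integer, let ε₁, …, ε_{c−1} ∈ {+1, −1} be any signs, and let ω = ȳ^{aε₁} · x̄^{bε₂} · ȳ^{aε₃} ⋯ ȳ^{aε_{c−1}} be the alternating product with c−1 factors, whose odd-position factors are powers of ȳ and whose even-position factors are powers of x̄. Then x̄^b · ω · x̄^{−b} · ω⁻¹ ≠ 1 in G. -/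
open Monoid

/-- A nonempty reduced word represents a nontrivial element of the free product. -/
theorem Monoid.CoprodI.NeWord.prod_ne_one {ι : Type*} {M : ι → Type*} [∀ i, Monoid (M i)]
    {i j : ι} (w : CoprodI.NeWord M i j) : w.prod ≠ 1 := by
  classical
  intro h
  have hnil : w.toWord = CoprodI.Word.empty :=
    CoprodI.Word.equiv.symm.injective (h.trans CoprodI.Word.prod_empty.symm)
  exact w.toList_ne_nil (congrArg CoprodI.Word.toList hnil)

/-- An alternating product of odd length of nontrivial letters, starting with a letter indexed by
`false`, is represented by a reduced word. -/
theorem exists_neWord_prod_eq_alternating {M : Bool → Type*} [∀ i, Monoid (M i)]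
    (y : ℕ → M false) (x : ℕ → M true) (hy : ∀ j, y j ≠ 1) (hx : ∀ j, x j ≠ 1) (n : ℕ) :
    ∃ w : CoprodI.NeWord M false false, w.prod =
      ((List.range (2 * n + 1)).map (fun j =>
        if (j + 1) % 2 = 1 then CoprodI.of (y j) else CoprodI.of (x j))).prod := by
  induction n with
  | zero => exact ⟨.singleton (y 0) (hy 0), by simp⟩
  | succ n ih =>
    obtain ⟨w, hw⟩ := ih
    refine ⟨.append (.append w Bool.false_ne_true (.singleton (x (2 * n + 1)) (hx _)))
      Bool.false_ne_true.symm (.singleton (y (2 * n + 2)) (hy _)), ?_⟩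
    have h₁ : ¬ (2 * n + 1 + 1) % 2 = 1 := by omega
    have h₂ : (2 * n + 2 + 1) % 2 = 1 := by omega
    rw [show 2 * (n + 1) + 1 = 2 * n + 1 + 1 + 1 by ring, List.range_succ, List.range_succ]
    simp only [CoprodI.NeWord.append_prod, CoprodI.NeWord.prod_singleton, List.map_append,
      List.prod_append, List.map_cons, List.map_nil, List.prod_singleton, hw, if_neg h₁, if_pos h₂]

/-- A power of the generator of a nontrivial cyclic group with exponent coprime to the order is
nontrivial. -/
theorem ofAdd_one_zpow_ne_one {m : ℕ} (hm : 2 ≤ m) {k : ℤ} (hk : IsCoprime (m : ℤ) k) :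
    Multiplicative.ofAdd (1 : ZMod m) ^ k ≠ 1 := by
  intro h
  rw [← ofAdd_zsmul, ofAdd_eq_one, zsmul_one, ZMod.intCast_zmod_eq_zero_iff_dvd] at h
  have := Int.isUnit_iff.mp (hk.isUnit_of_dvd' dvd_rfl h)
  omega

/-- In the free product `(ℤ/p) ∗ (ℤ/q)`, for any even `c ≥ 2` and any choice of signs
`ε₁, …, ε_{c-1}`, the element `x̄^b · ω · x̄^(-b) · ω⁻¹` is nontrivial, where
`ω = ȳ^(a ε₁) · x̄^(b ε₂) · ⋯ · ȳ^(a ε_{c-1})` is the alternating product whose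
odd-position factors are powers of `ȳ` and whose even-position factors are powers of `x̄`. -/
theorem stmt5 (p q : ℕ) (hp : 2 ≤ p) (hq : 2 ≤ q) (a b : ℤ)
    (hab : a * (p : ℤ) + b * (q : ℤ) = 1)
    (c : ℕ) (hc : Even c) (hc2 : 2 ≤ c) (ε : ℕ → ℤ) (hε : ∀ i, ε i = 1 ∨ ε i = -1) :
    let xbar : Coprod (Multiplicative (ZMod p)) (Multiplicative (ZMod q)) :=
      Coprod.inl (Multiplicative.ofAdd (1 : ZMod p))
    let ybar : Coprod (Multiplicative (ZMod p)) (Multiplicative (ZMod q)) :=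
      Coprod.inr (Multiplicative.ofAdd (1 : ZMod q))
    let ω := ((List.range (c - 1)).map (fun j =>
      if (j + 1) % 2 = 1 then ybar ^ (a * ε (j + 1)) else xbar ^ (b * ε (j + 1)))).prod
    xbar ^ b * ω * xbar ^ (-b) * ω⁻¹ ≠ 1 := by
  intro xbar ybar ω
  have hcop : ∀ {m k : ℤ} (j : ℕ), IsCoprime m k → IsCoprime m (k * ε j) := by
    intro m k j h
    rcases hε j with h₁ | h₁ <;> simpa [h₁, IsCoprime.neg_right_iff] using h
  have hb : IsCoprime (p : ℤ) b := ⟨a, q, by linarith⟩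
  have ha : IsCoprime (q : ℤ) a := ⟨b, p, by linarith⟩
  let M : Bool → Type := fun i => Multiplicative (ZMod (cond i p q))
  let x : M true := Multiplicative.ofAdd (1 : ZMod p)
  let y : M false := Multiplicative.ofAdd (1 : ZMod q)
  let φ : Coprod (Multiplicative (ZMod p)) (Multiplicative (ZMod q)) →* CoprodI M :=
    Coprod.lift (CoprodI.of (M := M) (i := true)) (CoprodI.of (M := M) (i := false))
  have hφx : φ xbar = CoprodI.of x := Coprod.lift_apply_inl _ _ _
  have hφy : φ ybar = CoprodI.of y := Coprod.lift_apply_inr _ _ _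
  have hx : x ^ b ≠ 1 := ofAdd_one_zpow_ne_one hp hb
  obtain ⟨n, hn⟩ : ∃ n, c - 1 = 2 * n + 1 := by
    obtain ⟨r, rfl⟩ := hc
    exact ⟨r - 1, by omega⟩
  obtain ⟨w, hw⟩ := exists_neWord_prod_eq_alternating
    (fun j => y ^ (a * ε (j + 1))) (fun j => x ^ (b * ε (j + 1)))
    (fun j => ofAdd_one_zpow_ne_one hq (hcop (j + 1) ha))
    (fun j => ofAdd_one_zpow_ne_one hp (hcop (j + 1) hb)) n
  have hφω : φ ω = w.prod := by
    rw [hw, ← hn, map_list_prod, List.map_map]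
    refine congrArg List.prod (List.map_congr_left fun j _ => ?_)
    simp only [Function.comp_apply, apply_ite φ, map_zpow, hφx, hφy]
  intro h
  refine CoprodI.NeWord.prod_ne_one
    (.append (.append (.append (.singleton (x ^ b) hx) Bool.false_ne_true.symm w)
      Bool.false_ne_true (.singleton (x ^ b)⁻¹ (inv_ne_one.mpr hx)))
      Bool.false_ne_true.symm w.inv) ?_
  simpa only [CoprodI.NeWord.append_prod, CoprodI.NeWord.prod_singleton,
    CoprodI.NeWord.inv_prod, map_mul, map_inv, map_zpow, map_one, hφx, hφω, zpow_neg]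
    using congrArg φ h
end

section
/- Let p, q ≥ 2 be coprime integers and let a, b be integers with a·p + b·q = 1. Let G be the group presented by ⟨x, y | x^p y^{−q}⟩ (the torus knot group, with relation x^p = y^q). Let c ≥ 2 be an even integer, let ε₁, …, ε_{c−1} ∈ {+1, −1} be any signs, and let ω = y^{aε₁} · x^{bε₂} · y^{aε₃} ⋯ y^{aε_{c−1}} be the alternating product with c−1 factors, whose odd-position factors are powers of y and whose even-position factors are powers of x. Then x^b · ω · x^{−b} · ω⁻¹ ≠ 1 in G. -/
namespace Monoid.CoprodI

variable {ι : Type*} {M : ι → Type*} [∀ i, Monoid (M i)]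

theorem NeWord.prod_ne_one_s6 {i j : ι} (w : NeWord M i j) : w.prod ≠ 1 := by
  classical
  intro h
  have h_empty : w.toWord = Word.empty :=
    Word.equiv.symm.injective (h.trans Word.prod_empty.symm)
  exact w.toList_ne_nil (congrArg Word.toList h_empty)

/-- An alternating product of odd length with nontrivial factors is a reduced word. -/
theorem exists_neWord_prod_eq_alternating {i k : ι} (hik : i ≠ k) (u : ℕ → M i) (v : ℕ → M k)
    (hu : ∀ j, u j ≠ 1) (hv : ∀ j, v j ≠ 1) (n : ℕ) :
    ∃ w : NeWord M i i, w.prod = ((List.range (2 * n + 1)).map (fun j =>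
      if (j + 1) % 2 = 1 then of (u (j + 1)) else of (v (j + 1)))).prod := by
  induction n with
  | zero => exact ⟨.singleton (u 1) (hu 1), by simp⟩
  | succ n ih =>
    obtain ⟨w, hw⟩ := ih
    refine ⟨.append w hik (.append (.singleton (v (2 * n + 2)) (hv _)) hik.symm
      (.singleton (u (2 * n + 3)) (hu _))), ?_⟩
    have h_even : (2 * n + 1 + 1) % 2 ≠ 1 := by omega
    have h_odd : (2 * n + 1 + 1 + 1) % 2 = 1 := by omega
    rw [show 2 * (n + 1) + 1 = 2 * n + 1 + 1 + 1 by ring, List.range_succ,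
      List.range_succ (n := 2 * n + 1)]
    simp only [List.map_append, List.prod_append, List.map_cons, List.map_nil, List.prod_cons,
      List.prod_nil, mul_one, if_neg h_even, if_pos h_odd, NeWord.append_prod,
      NeWord.prod_singleton, hw, mul_assoc]

end Monoid.CoprodI

theorem Multiplicative.ofAdd_one_zmod_zpow_ne_one {n : ℕ} (hn : 2 ≤ n) {k l m : ℤ}
    (h : k * m + l * (n : ℤ) = 1) :
    (Multiplicative.ofAdd (1 : ZMod n)) ^ k ≠ 1 := by
  have : Fact (1 < n) := ⟨hn⟩
  intro hk
  rw [← ofAdd_zsmul, ofAdd_eq_one, zsmul_one] at hk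
  have := congrArg (Int.cast : ℤ → ZMod n) h
  simp [hk] at this

/-- In the torus knot group `G = ⟨x, y | x^p = y^q⟩` with `p, q ≥ 2` coprime and
`a·p + b·q = 1`, for any even `c ≥ 2` and any choice of signs `ε₁, …, ε_{c-1}`, the element
`x^b · ω · x^(-b) · ω⁻¹` is nontrivial, where `ω = y^(a ε₁) · x^(b ε₂) · ⋯ · y^(a ε_{c-1})`
is the alternating product whose odd-position factors are powers of `y` and whose
even-position factors are powers of `x`. -/
theorem stmt6 (p q : ℕ) (hp : 2 ≤ p) (hq : 2 ≤ q) (hpq : Nat.Coprime p q) (a b : ℤ)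
    (hab : a * (p : ℤ) + b * (q : ℤ) = 1)
    (c : ℕ) (hc : Even c) (hc2 : 2 ≤ c) (ε : ℕ → ℤ) (hε : ∀ i, ε i = 1 ∨ ε i = -1) :
    let G := PresentedGroup
      ({FreeGroup.of 0 ^ (p : ℤ) * FreeGroup.of 1 ^ (-(q : ℤ))} : Set (FreeGroup (Fin 2)))
    let x : G := PresentedGroup.of 0
    let y : G := PresentedGroup.of 1
    let ω := ((List.range (c - 1)).map (fun j =>
      if (j + 1) % 2 = 1 then y ^ (a * ε (j + 1)) else x ^ (b * ε (j + 1)))).prod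
    x ^ b * ω * x ^ (-b) * ω⁻¹ ≠ 1 := by
  open Monoid.CoprodI in
  intro G x y ω h
  let M : Fin 2 → Type := fun i => Multiplicative (ZMod (![p, q] i))
  let g (i : Fin 2) : M i := Multiplicative.ofAdd 1
  have hg (i : Fin 2) : g i ^ (![p, q] i : ℤ) = 1 := by
    simp [g, M, ← ofAdd_nsmul]
  have hrel : ∀ r ∈ ({FreeGroup.of 0 ^ (p : ℤ) * FreeGroup.of 1 ^ (-(q : ℤ))} :
      Set (FreeGroup (Fin 2))), FreeGroup.lift (fun i => (of (g i) : Monoid.CoprodI M)) r = 1 := by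
    rintro r rfl
    have h0 : g 0 ^ (p : ℤ) = 1 := hg 0
    have h1 : g 1 ^ (q : ℤ) = 1 := hg 1
    rw [map_mul, map_zpow, map_zpow, FreeGroup.lift_apply_of, FreeGroup.lift_apply_of,
      zpow_neg, ← map_zpow (of (M := M)), ← map_zpow (of (M := M)), h0, h1]
    simp
  let φ : G →* Monoid.CoprodI M := PresentedGroup.toGroup hrel
  have hφx (k : ℤ) : φ (x ^ k) = of (g 0 ^ k) := by
    rw [map_zpow, map_zpow, PresentedGroup.toGroup.of]
  have hφy (k : ℤ) : φ (y ^ k) = of (g 1 ^ k) := by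
    rw [map_zpow, map_zpow, PresentedGroup.toGroup.of]
  have hx : g 0 ^ b ≠ 1 :=
    Multiplicative.ofAdd_one_zmod_zpow_ne_one hp (l := a) (m := q) (by linarith)
  have hy : g 1 ^ a ≠ 1 :=
    Multiplicative.ofAdd_one_zmod_zpow_ne_one hq (l := b) (m := p) hab
  have hu (j : ℕ) : g 1 ^ (a * ε j) ≠ 1 := by
    rcases hε j with h | h <;> simpa [h] using hy
  have hv (j : ℕ) : g 0 ^ (b * ε j) ≠ 1 := by
    rcases hε j with h | h <;> simpa [h] using hx
  obtain ⟨n, hn⟩ : ∃ n, c - 1 = 2 * n + 1 := by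
    obtain ⟨m, rfl⟩ := hc
    exact ⟨m - 1, by omega⟩
  obtain ⟨w, hw⟩ := exists_neWord_prod_eq_alternating (one_ne_zero : (1 : Fin 2) ≠ 0) _ _ hu hv n
  have hφω : φ ω = w.prod := by
    rw [hw, ← hn, map_list_prod, List.map_map]
    congr 2
    funext j
    simp only [Function.comp_apply, apply_ite φ, hφx, hφy]
  have hx' : g 0 ^ (-b) ≠ 1 := by simpa using hx
  have h01 : (0 : Fin 2) ≠ 1 := zero_ne_one
  refine NeWord.prod_ne_one_s6 (.append (.append (.append (.singleton _ hx) h01 w) h01.symm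
    (.singleton _ hx')) h01 w.inv) ?_
  simp only [NeWord.append_prod, NeWord.prod_singleton, NeWord.inv_prod]
  rw [← hφω, ← hφx, ← hφx, ← map_inv, ← map_mul, ← map_mul, ← map_mul, h, map_one]
end

section
/- Let R = ℤ[t, t⁻¹] be the ring of Laurent polynomials over ℤ, and let A be the 4×4 integer matrix given as the block sum of [[1, 0], [−1, 1]] and [[−1, 0], [1, −1]]. Then the quotient of the free module R⁴ by the R-submodule generated by the four rows of the matrix t·A − Aᵀ is isomorphic as an R-module to (R/(t² − t + 1)) ⊕ (R/(t² − t + 1)). -/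
open LaurentPolynomial Matrix

/-- The relation matrix `t·A - Aᵀ` of the square knot, written out over any commutative ring. -/
theorem smul_seifert_sub_transpose {R : Type*} [CommRing R] (t : R) :
    t • (!![1, 0, 0, 0; -1, 1, 0, 0; 0, 0, -1, 0; 0, 0, 1, -1] : Matrix (Fin 4) (Fin 4) R) -
      (!![1, 0, 0, 0; -1, 1, 0, 0; 0, 0, -1, 0; 0, 0, 1, -1] : Matrix (Fin 4) (Fin 4) R)ᵀ =
    !![t - 1, 1, 0, 0; -t, t - 1, 0, 0; 0, 0, 1 - t, -1; 0, 0, t, 1 - t] := by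
  ext i j
  fin_cases i <;> fin_cases j <;> simp <;> ring

/-- The linear map `R⁴ → R²` eliminating the second generator of each block. -/
def blockElimination {R : Type*} [CommRing R] (t : R) : (Fin 4 → R) →ₗ[R] R × R :=
  LinearMap.prod
    (LinearMap.proj (R := R) (φ := fun _ : Fin 4 => R) 0 + (1 - t) • LinearMap.proj 1)
    (LinearMap.proj (R := R) (φ := fun _ : Fin 4 => R) 2 + (1 - t) • LinearMap.proj 3)

theorem blockElimination_apply {R : Type*} [CommRing R] (t : R) (v : Fin 4 → R) :
    blockElimination t v = (v 0 + (1 - t) * v 1, v 2 + (1 - t) * v 3) :=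
  rfl

/-- The map `R⁴ → (R/(t² - t + 1))²` presenting the Alexander module of the square knot. -/
def blockQuotient {R : Type*} [CommRing R] (t : R) :
    (Fin 4 → R) →ₗ[R]
      (R ⧸ Ideal.span ({t ^ 2 - t + 1} : Set R)) × (R ⧸ Ideal.span ({t ^ 2 - t + 1} : Set R)) :=
  ((Ideal.Quotient.mkₐ R (Ideal.span {t ^ 2 - t + 1})).toLinearMap.prodMap
    (Ideal.Quotient.mkₐ R (Ideal.span {t ^ 2 - t + 1})).toLinearMap).comp (blockElimination t)

theorem blockQuotient_surjective {R : Type*} [CommRing R] (t : R) :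
    Function.Surjective (blockQuotient t) := by
  rintro ⟨x, y⟩
  obtain ⟨a, rfl⟩ := Ideal.Quotient.mk_surjective x
  obtain ⟨b, rfl⟩ := Ideal.Quotient.mk_surjective y
  exact ⟨![a, 0, b, 0], by simp [blockQuotient, blockElimination_apply]⟩

theorem mem_ker_blockQuotient {R : Type*} [CommRing R] (t : R) (v : Fin 4 → R) :
    v ∈ LinearMap.ker (blockQuotient t) ↔
      t ^ 2 - t + 1 ∣ v 0 + (1 - t) * v 1 ∧ t ^ 2 - t + 1 ∣ v 2 + (1 - t) * v 3 := by
  rw [LinearMap.mem_ker, blockQuotient, LinearMap.comp_apply, blockElimination_apply,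
    LinearMap.prodMap_apply, Prod.mk_eq_zero, AlgHom.toLinearMap_apply,
    AlgHom.toLinearMap_apply, Ideal.Quotient.mkₐ_eq_mk, Ideal.Quotient.eq_zero_iff_dvd,
    Ideal.Quotient.eq_zero_iff_dvd]

theorem span_rows_eq_ker_blockQuotient {R : Type*} [CommRing R] (t : R) :
    Submodule.span R (Set.range fun i =>
      (!![t - 1, 1, 0, 0; -t, t - 1, 0, 0; 0, 0, 1 - t, -1; 0, 0, t, 1 - t] :
        Matrix (Fin 4) (Fin 4) R) i) = LinearMap.ker (blockQuotient t) := by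
  apply le_antisymm
  · rw [Submodule.span_le]
    rintro _ ⟨i, rfl⟩
    rw [SetLike.mem_coe, mem_ker_blockQuotient]
    fin_cases i
    · exact ⟨⟨0, by simp⟩, ⟨0, by simp⟩⟩
    · exact ⟨⟨-1, by simp; ring⟩, ⟨0, by simp⟩⟩
    · exact ⟨⟨0, by simp⟩, ⟨0, by simp⟩⟩
    · exact ⟨⟨0, by simp⟩, ⟨1, by simp; ring⟩⟩
  · intro v hv
    obtain ⟨⟨a, ha⟩, ⟨b, hb⟩⟩ := (mem_ker_blockQuotient t v).1 hv
    rw [Submodule.mem_span_range_iff_exists_fun]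
    refine ⟨![v 1 + a * (t - 1), -a, -(v 3 + b * (t - 1)), b], ?_⟩
    ext j
    fin_cases j <;> simp [Fin.sum_univ_four]
    · linear_combination -ha
    · linear_combination -hb
    · ring

/-- Let `R = ℤ[t, t⁻¹]` and let `A` be the block sum of `[[1,0],[-1,1]]` and
`[[-1,0],[1,-1]]` (the Seifert matrix of the square knot). Then the quotient of `R⁴`
by the submodule generated by the rows of `t·A - Aᵀ` is isomorphic as an `R`-module to
`R/(t² - t + 1) ⊕ R/(t² - t + 1)`. -/
theorem stmt8 :
    let R := LaurentPolynomial ℤ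
    let A : Matrix (Fin 4) (Fin 4) R :=
      !![1, 0, 0, 0; -1, 1, 0, 0; 0, 0, -1, 0; 0, 0, 1, -1]
    let M : Matrix (Fin 4) (Fin 4) R := (T 1 : R) • A - Aᵀ
    Nonempty (((Fin 4 → R) ⧸ Submodule.span R (Set.range fun i => M i)) ≃ₗ[R]
      (R ⧸ Ideal.span ({T 2 - T 1 + 1} : Set R)) × (R ⧸ Ideal.span ({T 2 - T 1 + 1} : Set R))) := by
  intro R A M
  have hT : (T 2 : R) = T 1 ^ 2 := by rw [T_pow]; norm_num
  have hM : M = _ := smul_seifert_sub_transpose (T 1 : R)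
  rw [hM, hT, span_rows_eq_ker_blockQuotient]
  exact ⟨(blockQuotient (T 1 : R)).quotKerEquivOfSurjective (blockQuotient_surjective _)⟩
end
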